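/- arXiv:1401.1763 — 3 statements merged into one kernel-verified Lean document; each statement's English description precedes it below -/
import Mathlib

section
/- Let N and L be positive integers, and on a probability space let C_1,…,C_N and B_{i,j} (for i ∈ [N], j ∈ [L]) be events with P(C_i) > 0 for all i. Define A_i = C_i ∩ ⋂_{j=1}^{L} (B_{i,j})ᶜ. Suppose that (1) for all i ≠ j in [N], P(C_i ∩ C_j) ≤ P(C_i)·P(C_j); (2) Σ_{i=1}^{N} P(C_i) = a; and (3) for every i ∈ [N], Σ_{j=1}^{L} P(B_{i,j} | C_i) ≤ b. Then P(⋃_{i=1}^{N} A_i) ≥ a(1 − 0.5a − b). -/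
open MeasureTheory

/-- A Bonferroni-type lower bound for the measure of a finite union of sets whose pairwise
intersections have measure at most the product of given weights. -/
theorem sum_measureReal_sub_sq_le_measureReal_biUnion {ι Ω : Type*} [MeasurableSpace Ω]
    (P : Measure Ω) [IsFiniteMeasure P] (A : ι → Set Ω) (hA : ∀ i, MeasurableSet (A i))
    (c : ι → ℝ) (hc : ∀ i j, i ≠ j → P.real (A i ∩ A j) ≤ c i * c j) (s : Finset ι) :
    ∑ i ∈ s, P.real (A i) - (∑ i ∈ s, c i) ^ 2 / 2 ≤ P.real (⋃ i ∈ s, A i) := by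
  classical
  induction s using Finset.induction_on with
  | empty => simp
  | insert k s hk ih =>
    rw [Finset.sum_insert hk, Finset.sum_insert hk, Finset.set_biUnion_insert]
    have hunion := measureReal_union_add_inter (μ := P) (s := A k)
      (Finset.measurableSet_biUnion s fun i _ => hA i) (measure_ne_top _ _) (measure_ne_top _ _)
    have hinter : P.real (A k ∩ ⋃ i ∈ s, A i) ≤ c k * ∑ i ∈ s, c i := by
      rw [Set.inter_iUnion₂, Finset.mul_sum]
      refine (measureReal_biUnion_finset_le s _).trans (Finset.sum_le_sum fun i hi => ?_)
      exact hc k i fun h => hk (h ▸ hi)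
    nlinarith [sq_nonneg (c k)]

/-- Removing finitely many sets `B j` from `C` decreases the measure by at most the sum of the
measures of the sets `B j ∩ C`. -/
theorem measureReal_sub_sum_le_measureReal_inter_iInter_compl {ι Ω : Type*} [Fintype ι]
    [MeasurableSpace Ω] (P : Measure Ω) [IsFiniteMeasure P] (C : Set Ω) (B : ι → Set Ω) :
    P.real C - ∑ j, P.real (B j ∩ C) ≤ P.real (C ∩ ⋂ j, (B j)ᶜ) := by
  have hsub : C ⊆ (C ∩ ⋂ j, (B j)ᶜ) ∪ ⋃ j, B j ∩ C := by
    intro x hx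
    by_cases h : ∃ j, x ∈ B j
    · obtain ⟨j, hj⟩ := h
      exact Or.inr (Set.mem_iUnion.2 ⟨j, hj, hx⟩)
    · exact Or.inl ⟨hx, Set.mem_iInter.2 fun j hj => h ⟨j, hj⟩⟩
  linarith [measureReal_mono (μ := P) hsub,
    measureReal_union_le (μ := P) (C ∩ ⋂ j, (B j)ᶜ) (⋃ j, B j ∩ C),
    measureReal_iUnion_fintype_le (μ := P) fun j => B j ∩ C]

/-- the "Noisy Lemma". For events `C i` with positive probability and noisy
events `B i j`, define `A i = C i ∩ ⋂ j, (B i j)ᶜ`. If `P(C i ∩ C j) ≤ P(C i) P(C j)` for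
`i ≠ j`, `∑ i, P(C i) = a`, and `∑ j, P(B i j | C i) ≤ b` for every `i`, then
`P(⋃ i, A i) ≥ a (1 − 0.5 a − b)`. -/
theorem stmt_0 {Ω : Type*} [MeasurableSpace Ω] (P : Measure Ω) [IsProbabilityMeasure P]
    (N L : ℕ) (hN : 0 < N) (hL : 0 < L)
    (C : Fin N → Set Ω) (B : Fin N → Fin L → Set Ω)
    (hCmeas : ∀ i, MeasurableSet (C i)) (hBmeas : ∀ i j, MeasurableSet (B i j))
    (hCpos : ∀ i, 0 < (P (C i)).toReal)
    (A : Fin N → Set Ω)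
    (hA : ∀ i, A i = C i ∩ ⋂ j, (B i j)ᶜ)
    (a b : ℝ)
    (hCC : ∀ i j, i ≠ j → (P (C i ∩ C j)).toReal ≤ (P (C i)).toReal * (P (C j)).toReal)
    (ha : ∑ i, (P (C i)).toReal = a)
    (hb : ∀ i, ∑ j, (P (B i j ∩ C i)).toReal / (P (C i)).toReal ≤ b) :
    (P (⋃ i, A i)).toReal ≥ a * (1 - 0.5 * a - b) := by
  have hAmeas : ∀ i, MeasurableSet (A i) := fun i => by
    rw [hA]
    exact (hCmeas i).inter (MeasurableSet.iInter fun j => (hBmeas i j).compl)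
  have hAC : ∀ i, A i ⊆ C i := fun i => by
    rw [hA]
    exact Set.inter_subset_left
  have hunion := sum_measureReal_sub_sq_le_measureReal_biUnion P A hAmeas
    (fun i => (P (C i)).toReal)
    (fun i j hij => (measureReal_mono (Set.inter_subset_inter (hAC i) (hAC j))).trans
      (hCC i j hij)) Finset.univ
  have hlower : ∀ i, (P (C i)).toReal * (1 - b) ≤ P.real (A i) := fun i => by
    have hi := hb i
    rw [← Finset.sum_div, div_le_iff₀ (hCpos i)] at hi
    have hnoise := measureReal_sub_sum_le_measureReal_inter_iInter_compl P (C i) (B i)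
    rw [← hA] at hnoise
    simp only [Measure.real] at hnoise ⊢
    linarith
  have hsum := Finset.sum_le_sum fun i (_ : i ∈ Finset.univ) => hlower i
  rw [← Finset.sum_mul, ha] at hsum
  simp only [ha, Finset.mem_univ, Set.iUnion_true] at hunion
  change a * (1 - 0.5 * a - b) ≤ P.real (⋃ i, A i)
  linarith
end

section
/- Let N and L be positive integers, and on a probability space let C_1,…,C_N and B_{i,j} (for i ∈ [N], j ∈ [L]) be events with P(C_i) > 0 for all i. Define A_i = C_i ∩ ⋂_{j=1}^{L} (B_{i,j})ᶜ. Suppose that (1) for all i ≠ j in [N], P(C_i ∩ C_j) ≤ P(C_i)·P(C_j); (2) Σ_{i=1}^{N} P(C_i) = a; (3) for every i ∈ [N], Σ_{j=1}^{L} P(B_{i,j} | C_i) ≤ b; and additionally b < 0.1. Then P(⋃_{i=1}^{N} A_i) ≥ min{0.8a, 0.04}. -/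
open MeasureTheory

/-- A one-sided Bonferroni bound: if each `A i` is a subset of `C i` of measure at least a fraction
`c`, and the `C i` are pairwise non-positively correlated, then the union of the `A i` has
measure at least `c * s - s ^ 2 / 2`, where `s` is the total measure of the `C i`. -/
theorem measureReal_biUnion_ge {Ω ι : Type*} [MeasurableSpace Ω] (P : Measure Ω)
    [IsFiniteMeasure P] {A C : ι → Set Ω} {c : ℝ} (hA : ∀ i, MeasurableSet (A i))
    (hAC : ∀ i, A i ⊆ C i) (hc : ∀ i, c * P.real (C i) ≤ P.real (A i))
    (hC : ∀ i j, i ≠ j → P.real (C i ∩ C j) ≤ P.real (C i) * P.real (C j)) (I : Finset ι) :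
    c * ∑ i ∈ I, P.real (C i) - (∑ i ∈ I, P.real (C i)) ^ 2 / 2 ≤ P.real (⋃ i ∈ I, A i) := by
  classical
  induction I using Finset.induction_on with
  | empty => simp
  | insert i I hi ih =>
    rw [Finset.sum_insert hi, Finset.set_biUnion_insert]
    have hinter : P.real (A i ∩ ⋃ j ∈ I, A j) ≤ P.real (C i) * ∑ j ∈ I, P.real (C j) := by
      rw [Set.inter_iUnion₂, Finset.mul_sum]
      refine (measureReal_biUnion_finset_le _ _).trans (Finset.sum_le_sum fun j hj => ?_)
      exact (measureReal_mono (Set.inter_subset_inter (hAC i) (hAC j))).trans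
        (hC i j fun h => hi (h ▸ hj))
    have hunion := measureReal_union_add_inter (μ := P) (s := A i)
      (I.measurableSet_biUnion fun j _ => hA j)
      (measure_ne_top P _) (measure_ne_top P _)
    nlinarith [hc i, sq_nonneg (P.real (C i))]

/-- If the conditional probabilities of the `B j` given `C` sum to at most `b`, then removing all
the `B j` from `C` leaves at least a fraction `1 - b` of it. -/
theorem measureReal_inter_iInter_compl_ge {Ω κ : Type*} [Fintype κ] [MeasurableSpace Ω]
    (P : Measure Ω) [IsFiniteMeasure P] {C : Set Ω} {B : κ → Set Ω} {b : ℝ}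
    (hC : 0 < P.real C) (hb : ∑ j, P.real (B j ∩ C) / P.real C ≤ b) :
    (1 - b) * P.real C ≤ P.real (C ∩ ⋂ j, (B j)ᶜ) := by
  rw [← Finset.sum_div, div_le_iff₀ hC] at hb
  have hsub : C ⊆ (C ∩ ⋂ j, (B j)ᶜ) ∪ ⋃ j, B j ∩ C := by
    intro x hx
    by_cases h : ∃ j, x ∈ B j
    · obtain ⟨j, hj⟩ := h
      exact Or.inr (Set.mem_iUnion.2 ⟨j, hj, hx⟩)
    · exact Or.inl ⟨hx, Set.mem_iInter.2 fun j hj => h ⟨j, hj⟩⟩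
  have hle := (measureReal_mono (μ := P) hsub).trans (measureReal_union_le _ _)
  have hB := measureReal_iUnion_fintype_le (μ := P) fun j => B j ∩ C
  linarith

/-- If all terms are at most `u` and the total is at least `l`, some partial sum lies between `l`
and `l + u`. -/
theorem Finset.exists_sum_mem_Icc {ι : Type*} {p : ι → ℝ} {l u : ℝ} (hl : 0 < l)
    (hp : ∀ i, p i ≤ u) (I : Finset ι) (hI : l ≤ ∑ i ∈ I, p i) :
    ∃ J : Finset ι, ∑ i ∈ J, p i ∈ Set.Icc l (l + u) := by
  classical
  induction I using Finset.induction_on with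
  | empty => exact absurd hI (by simpa using hl)
  | insert i I hi ih =>
    by_cases h : l ≤ ∑ i ∈ I, p i
    · exact ih h
    · refine ⟨insert i I, hI, ?_⟩
      rw [Finset.sum_insert hi]
      linarith [hp i]

/-- corollary of the "Noisy Lemma". Under the hypotheses of the Noisy Lemma and
additionally `b < 0.1`, one has `P(⋃ i, A i) ≥ min (0.8 a) 0.04`. -/
theorem stmt_1 {Ω : Type*} [MeasurableSpace Ω] (P : Measure Ω) [IsProbabilityMeasure P]
    (N L : ℕ) (hN : 0 < N) (hL : 0 < L)
    (C : Fin N → Set Ω) (B : Fin N → Fin L → Set Ω)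
    (hCmeas : ∀ i, MeasurableSet (C i)) (hBmeas : ∀ i j, MeasurableSet (B i j))
    (hCpos : ∀ i, 0 < (P (C i)).toReal)
    (A : Fin N → Set Ω)
    (hA : ∀ i, A i = C i ∩ ⋂ j, (B i j)ᶜ)
    (a b : ℝ)
    (hCC : ∀ i j, i ≠ j → (P (C i ∩ C j)).toReal ≤ (P (C i)).toReal * (P (C j)).toReal)
    (ha : ∑ i, (P (C i)).toReal = a)
    (hb : ∀ i, ∑ j, (P (B i j ∩ C i)).toReal / (P (C i)).toReal ≤ b)
    (hb01 : b < 0.1) :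
    (P (⋃ i, A i)).toReal ≥ min (0.8 * a) 0.04 := by
  simp only [← measureReal_def] at *
  have hAge : ∀ i, 0.9 * P.real (C i) ≤ P.real (A i) := fun i => by
    have := measureReal_inter_iInter_compl_ge P (hCpos i) (hb i)
    rw [← hA i] at this
    nlinarith [hCpos i]
  have hAmeas : ∀ i, MeasurableSet (A i) := fun i => by
    rw [hA i]
    exact (hCmeas i).inter (MeasurableSet.iInter fun j => (hBmeas i j).compl)
  have hAC : ∀ i, A i ⊆ C i := fun i => by
    rw [hA i]
    exact Set.inter_subset_left
  have hpartial : ∀ I : Finset (Fin N), ∑ i ∈ I, P.real (C i) ≤ 0.2 →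
      0.8 * ∑ i ∈ I, P.real (C i) ≤ P.real (⋃ i, A i) := fun I hI => by
    have hbonf := measureReal_biUnion_ge P hAmeas hAC hAge hCC I
    have hmono : P.real (⋃ i ∈ I, A i) ≤ P.real (⋃ i, A i) :=
      measureReal_mono (Set.iUnion₂_subset_iUnion _ _)
    have hnonneg : 0 ≤ ∑ i ∈ I, P.real (C i) := Finset.sum_nonneg fun i _ => (hCpos i).le
    nlinarith
  rcases le_or_gt a 0.2 with hsmall | hlarge
  · exact (min_le_left _ _).trans (ha ▸ hpartial Finset.univ (ha ▸ hsmall))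
  refine (min_le_right _ _).trans ?_
  by_cases hbig : ∃ i, 0.05 < P.real (C i)
  · obtain ⟨i, hi⟩ := hbig
    have hmono : P.real (A i) ≤ P.real (⋃ i, A i) := measureReal_mono (Set.subset_iUnion A i)
    linarith [hAge i]
  · push Not at hbig
    obtain ⟨J, hJl, hJu⟩ := Finset.exists_sum_mem_Icc (l := 0.05) (by norm_num) hbig Finset.univ
      (by linarith)
    linarith [hpartial J (by linarith)]
end

section
/- For every positive integer k there exists a constant α_k depending only on k such that the following holds: let n be a positive integer and V ∈ ℝ^n a vector with strictly positive integer entries v_1,…,v_n; let μ = (1/n) Σ_{i=1}^{n} v_i (so μ ≥ 1); let X_1,…,X_n be random variables where each X_i is binomially distributed with parameters v_i and μ^{−1}, and set X = Σ_{i=1}^{n} X_i^k. Then P( X > α_k μ^{−k} Σ_{i=1}^{n} v_i^k ) < 0.1. -/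
open MeasureTheory

lemma Nat.pow_le_const_add_two_pow_mul_descFactorial (x k : ℕ) :
    x ^ k ≤ (2 * k) ^ k + 2 ^ k * x.descFactorial k := by
  rcases le_total x (2 * k) with h | h
  · exact (Nat.pow_le_pow_left h k).trans (Nat.le_add_right _ _)
  · calc x ^ k ≤ (2 * (x + 1 - k)) ^ k := Nat.pow_le_pow_left (by omega) k
      _ = 2 ^ k * (x + 1 - k) ^ k := mul_pow ..
      _ ≤ 2 ^ k * x.descFactorial k :=
        Nat.mul_le_mul_left _ (Nat.pow_sub_le_descFactorial x k)
      _ ≤ _ := Nat.le_add_left _ _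

/-- The `k`-th factorial moment of the binomial distribution. -/
lemma sum_binomial_mul_descFactorial (v k : ℕ) (p : ℝ) :
    ∑ l ∈ Finset.range (v + 1),
      (v.choose l : ℝ) * p ^ l * (1 - p) ^ (v - l) * (l.descFactorial k : ℝ) =
        (v.descFactorial k : ℝ) * p ^ k := by
  rcases lt_or_ge v k with h | h
  · rw [Nat.descFactorial_of_lt h, Finset.sum_eq_zero]
    · simp
    · intro l hl
      rw [Nat.descFactorial_of_lt (by grind)]
      simp
  · obtain ⟨m, rfl⟩ := Nat.exists_eq_add_of_le h
    rw [add_assoc, Finset.sum_range_add, Finset.sum_eq_zero, zero_add]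
    · have key (j : ℕ) (hj : j ∈ Finset.range (m + 1)) :
          ((k + m).choose (k + j) : ℝ) * p ^ (k + j) * (1 - p) ^ (k + m - (k + j)) *
            ((k + j).descFactorial k : ℝ) =
          ((k + m).descFactorial k : ℝ) * p ^ k *
            (p ^ j * (1 - p) ^ (m - j) * (m.choose j : ℝ)) := by
        have hc : ((k + m).choose (k + j) : ℝ) * ((k + j).choose k : ℝ) =
            ((k + m).choose k : ℝ) * (m.choose j : ℝ) := by
          have := Nat.choose_mul (n := k + m) (k := k + j) (s := k)
            (Nat.le_add_right k j)
          simp only [Nat.add_sub_cancel_left] at this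
          exact_mod_cast this
        rw [Nat.add_sub_add_left, Nat.descFactorial_eq_factorial_mul_choose,
          Nat.descFactorial_eq_factorial_mul_choose, pow_add]
        push_cast
        linear_combination (p ^ k * p ^ j * (1 - p) ^ (m - j) * (k.factorial : ℝ)) * hc
      rw [Finset.sum_congr rfl key, ← Finset.mul_sum, ← add_pow]
      simp
    · intro l hl
      rw [Nat.descFactorial_of_lt (Finset.mem_range.mp hl)]
      simp

lemma eq_sum_indicator_of_le {Ω : Type*} {X : Ω → ℕ} {v : ℕ} (hv : ∀ ω, X ω ≤ v)
    (f : ℕ → ℝ) :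
    (fun ω => f (X ω)) =
      fun ω => ∑ l ∈ Finset.range (v + 1), {ω | X ω = l}.indicator (fun _ => f l) ω := by
  funext ω
  rw [Finset.sum_eq_single (X ω)]
  · simp
  · intro l _ hl
    simp [hl.symm]
  · intro h
    exact absurd (Finset.mem_range.mpr (Nat.lt_succ_of_le (hv ω))) h

section BoundedNat

variable {Ω : Type*} [MeasurableSpace Ω] {P : Measure Ω} [IsFiniteMeasure P] {X : Ω → ℕ} {v : ℕ}

lemma integrable_comp_of_le (hX : Measurable X) (hv : ∀ ω, X ω ≤ v) (f : ℕ → ℝ) :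
    Integrable (fun ω => f (X ω)) P := by
  rw [eq_sum_indicator_of_le hv f]
  exact integrable_finsetSum _ fun l _ =>
    (integrable_const _).indicator (hX (measurableSet_singleton l))

lemma integral_comp_of_le (hX : Measurable X) (hv : ∀ ω, X ω ≤ v) (f : ℕ → ℝ) :
    ∫ ω, f (X ω) ∂P = ∑ l ∈ Finset.range (v + 1), (P {ω | X ω = l}).toReal * f l := by
  have hm (l : ℕ) : MeasurableSet {ω | X ω = l} := hX (measurableSet_singleton l)
  rw [eq_sum_indicator_of_le hv f, integral_finsetSum _ fun l _ =>
    (integrable_const _).indicator (hm l)]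
  refine Finset.sum_congr rfl fun l _ => ?_
  rw [integral_indicator_const _ (hm l), smul_eq_mul, Measure.real]

end BoundedNat

lemma integral_pow_le_of_binomial {Ω : Type*} [MeasurableSpace Ω] {P : Measure Ω}
    [IsProbabilityMeasure P] {X : Ω → ℕ} {v : ℕ} {p : ℝ} (hp : 0 ≤ p) (hX : Measurable X)
    (hv : ∀ ω, X ω ≤ v)
    (hd : ∀ l, (P {ω | X ω = l}).toReal = (v.choose l : ℝ) * p ^ l * (1 - p) ^ (v - l))
    (k : ℕ) :
    ∫ ω, (X ω : ℝ) ^ k ∂P ≤ (2 * k : ℝ) ^ k + 2 ^ k * (p * v) ^ k := by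
  have hint := integrable_comp_of_le (P := P) hX hv fun l => (l.descFactorial k : ℝ)
  have hmoment : ∫ ω, ((X ω).descFactorial k : ℝ) ∂P = (v.descFactorial k : ℝ) * p ^ k := by
    rw [integral_comp_of_le hX hv fun l => (l.descFactorial k : ℝ),
      ← sum_binomial_mul_descFactorial]
    simp only [hd]
  calc ∫ ω, (X ω : ℝ) ^ k ∂P
      ≤ ∫ ω, ((2 * k : ℝ) ^ k + 2 ^ k * ((X ω).descFactorial k : ℝ)) ∂P := by
        refine integral_mono (integrable_comp_of_le hX hv fun l => (l : ℝ) ^ k)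
          ((integrable_const _).add (hint.const_mul _)) fun ω => ?_
        exact_mod_cast Nat.pow_le_const_add_two_pow_mul_descFactorial (X ω) k
    _ = (2 * k : ℝ) ^ k + 2 ^ k * ((v.descFactorial k : ℝ) * p ^ k) := by
        rw [integral_add (integrable_const _) (hint.const_mul _), integral_const_mul, hmoment]
        simp
    _ ≤ _ := by
        have : (v.descFactorial k : ℝ) ≤ (v : ℝ) ^ k := by
          exact_mod_cast Nat.descFactorial_le_pow v k
        rw [mul_pow p, mul_comm (p ^ k)]
        gcongr

lemma card_le_sum_pow_of_sum_eq_card {ι : Type*} [Fintype ι] {y : ι → ℝ} (hy : ∀ i, 0 ≤ y i)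
    (hsum : ∑ i, y i = Fintype.card ι) (k : ℕ) :
    (Fintype.card ι : ℝ) ≤ ∑ i, y i ^ k := by
  calc (Fintype.card ι : ℝ) = ∑ i, (1 + k * (y i - 1)) := by
        simp [Finset.sum_add_distrib, ← Finset.mul_sum, hsum]
    _ ≤ ∑ i, y i ^ k := Finset.sum_le_sum fun i _ => by
        simpa using one_add_mul_le_pow (a := y i - 1) (by linarith [hy i]) k

/-- For every positive integer `k` there is a constant `αk` depending only on `k`
such that: for strictly positive integer entries `v 1, …, v n` with mean `μ = (∑ v i)/n ≥ 1`,
and random variables `X i` each binomially distributed with parameters `v i` and `μ⁻¹`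
(no independence assumed), the sum `X = ∑ i, (X i)^k` satisfies
`P(X > αk μ^(-k) ∑ i, (v i)^k) < 0.1`. -/
theorem stmt_16 (k : ℕ) (hk : 0 < k) :
    ∃ αk : ℝ, 0 < αk ∧
      ∀ (Ω : Type) [MeasurableSpace Ω] (P : Measure Ω) [IsProbabilityMeasure P]
        (n : ℕ), 0 < n → ∀ (v : Fin n → ℕ), (∀ i, 0 < v i) →
        ∀ (X : Fin n → Ω → ℕ), (∀ i, Measurable (X i)) → (∀ i ω, X i ω ≤ v i) →
        (∀ i l, (P {ω | X i ω = l}).toReal =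
          ((v i).choose l : ℝ) * (((∑ a, (v a : ℝ)) / n)⁻¹) ^ l *
            (1 - ((∑ a, (v a : ℝ)) / n)⁻¹) ^ (v i - l)) →
        (P {ω | ∑ i, ((X i ω : ℝ)) ^ k >
            αk * (((∑ a, (v a : ℝ)) / n)⁻¹) ^ k * ∑ a, (v a : ℝ) ^ k}).toReal < 0.1 := by
  set C : ℝ := (2 * k : ℝ) ^ k + 2 ^ k with hC
  have hCpos : 0 < C := by positivity
  refine ⟨11 * C, by positivity, ?_⟩
  intro Ω _ P _ n hn v hv X hX hle hd
  set p : ℝ := ((∑ a, (v a : ℝ)) / n)⁻¹ with hp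
  have hn' : (0 : ℝ) < n := by exact_mod_cast hn
  have hsum_pos : 0 < ∑ a, (v a : ℝ) :=
    Finset.sum_pos (fun i _ => by exact_mod_cast hv i) ⟨⟨0, hn⟩, Finset.mem_univ _⟩
  have hp0 : 0 ≤ p := by positivity
  set S : ℝ := ∑ i, (p * v i) ^ k with hS
  have hS_eq : p ^ k * ∑ a, (v a : ℝ) ^ k = S := by
    simp only [hS, mul_pow, Finset.mul_sum]
  have hnS : (n : ℝ) ≤ S := by
    have hmean : ∑ i, p * (v i : ℝ) = Fintype.card (Fin n) := by
      rw [← Finset.mul_sum, hp, Fintype.card_fin]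
      field_simp
    simpa using card_le_sum_pow_of_sum_eq_card (fun i => by positivity) hmean k
  have hSpos : 0 < S := hn'.trans_le hnS
  have hint (i : Fin n) : Integrable (fun ω => (X i ω : ℝ) ^ k) P :=
    integrable_comp_of_le (hX i) (hle i) fun l => (l : ℝ) ^ k
  have hE : ∫ ω, ∑ i, (X i ω : ℝ) ^ k ∂P ≤ C * S := by
    rw [integral_finsetSum _ fun i _ => hint i]
    calc ∑ i, ∫ ω, (X i ω : ℝ) ^ k ∂P
        ≤ ∑ i, ((2 * k : ℝ) ^ k + 2 ^ k * (p * v i) ^ k) := Finset.sum_le_sum fun i _ =>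
          integral_pow_le_of_binomial hp0 (hX i) (hle i) (hd i) k
      _ = (2 * k : ℝ) ^ k * n + 2 ^ k * S := by
          simp [Finset.sum_add_distrib, ← Finset.mul_sum, hS, mul_comm]
      _ ≤ (2 * k : ℝ) ^ k * S + 2 ^ k * S := by gcongr
      _ = C * S := by rw [hC]; ring
  have hmarkov := mul_meas_ge_le_integral_of_nonneg (μ := P)
    (f := fun ω => ∑ i, (X i ω : ℝ) ^ k) (.of_forall fun ω => by positivity)
    (integrable_finsetSum _ fun i _ => hint i) (11 * C * S)
  rw [mul_assoc (11 * C), hS_eq]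
  have hmono : (P {ω | ∑ i, (X i ω : ℝ) ^ k > 11 * C * S}).toReal ≤
      P.real {ω | 11 * C * S ≤ ∑ i, (X i ω : ℝ) ^ k} :=
    measureReal_mono (Set.ofPred_subset_ofPred.mpr fun _ => le_of_lt)
  have hCS : 0 < C * S := by positivity
  have hbound : P.real {ω | 11 * C * S ≤ ∑ i, (X i ω : ℝ) ^ k} ≤ 1 / 11 := by
    refine le_of_mul_le_mul_left ?_ hCS
    linarith
  norm_num at hbound ⊢
  linarith
end
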